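/- arXiv:2103.01908 — 5 statements merged into one kernel-verified Lean document; each statement's English description precedes it below -/
import Mathlib

section
/- Let N, L be positive integers, let s_col ∈ {1,…,N}, and let C ∈ ℝ^{NL×NL} be a symmetric matrix with entries in {0,1} and zero diagonal, with rows and columns indexed by pairs (j,l) ∈ [N]×[L]. Assume that every matrix X ∈ ℝ^{N×L} with ‖X‖_{C,0} = 1 has at most s_col nonzero entries in each column. Let X ∈ ℝ^{N×L} be nonzero with s := ‖X‖_{C,0} < ∞, and assume X admits a minimal decomposition X = Σ_{k=1}^s Z_k into elementary matrices Z_k whose supports are pairwise disjoint (so that X₀₁ = Σ_{k=1}^s (Z_k)₀₁). Then (1/2)‖X‖_{C,0}² ≤ vec(X₀₁)ᵀ C vec(X₀₁) + 1 ≤ s_col² L² ‖X‖_{C,0}². -/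
open Matrix BigOperators

/-- Support indicator vector of a matrix, indexed by pairs `(j,l)`. -/
noncomputable def suppInd {N L : ℕ} (Z : Matrix (Fin N) (Fin L) ℝ) :
    (Fin N × Fin L) → ℝ :=
  fun p => if Z p.1 p.2 ≠ 0 then 1 else 0

/-- The quadratic form `vec(Z₀₁)ᵀ C vec(Z₀₁)`. -/
noncomputable def suppQuad {N L : ℕ} (C : Matrix (Fin N × Fin L) (Fin N × Fin L) ℝ)
    (Z : Matrix (Fin N) (Fin L) ℝ) : ℝ :=
  ∑ p, ∑ q, suppInd Z p * C p q * suppInd Z q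

/-- `Z` is an elementary structure for `C`. -/
def IsElementary {N L : ℕ} (C : Matrix (Fin N × Fin L) (Fin N × Fin L) ℝ)
    (Z : Matrix (Fin N) (Fin L) ℝ) : Prop :=
  suppQuad C Z = 0

/-- `Z ∈ S_C^s`: `Z` is a sum of `s` elementary structures. -/
def InStructSet {N L : ℕ} (C : Matrix (Fin N × Fin L) (Fin N × Fin L) ℝ) (s : ℕ)
    (Z : Matrix (Fin N) (Fin L) ℝ) : Prop :=
  ∃ Zs : Fin s → Matrix (Fin N) (Fin L) ℝ,
    Z = ∑ k, Zs k ∧ ∀ k, IsElementary C (Zs k)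

/-- The structured sparsity `‖Z‖_{C,0} = min {s : Z ∈ S_C^s}`. -/
noncomputable def normC0 {N L : ℕ} (C : Matrix (Fin N × Fin L) (Fin N × Fin L) ℝ)
    (Z : Matrix (Fin N) (Fin L) ℝ) : ℕ :=
  sInf {s : ℕ | InStructSet C s Z}

theorem suppInd_eq_zero_or_one {N L : ℕ} (Z : Matrix (Fin N) (Fin L) ℝ) (p : Fin N × Fin L) :
    suppInd Z p = 0 ∨ suppInd Z p = 1 := by
  unfold suppInd
  split_ifs <;> simp

theorem suppQuad_eq_dotProduct {N L : ℕ} (C : Matrix (Fin N × Fin L) (Fin N × Fin L) ℝ)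
    (Z : Matrix (Fin N) (Fin L) ℝ) :
    suppQuad C Z = suppInd Z ⬝ᵥ C *ᵥ suppInd Z := by
  simp only [suppQuad, dotProduct, mulVec, Finset.mul_sum, mul_assoc]

/-- A bilinear form with `0`-`1` coefficients takes natural values on `0`-`1` vectors. -/
theorem exists_nat_dotProduct_mulVec {ι : Type*} [Fintype ι] (C : Matrix ι ι ℝ)
    (hC : ∀ p q, C p q = 0 ∨ C p q = 1) (u v : ι → ℝ)
    (hu : ∀ p, u p = 0 ∨ u p = 1) (hv : ∀ p, v p = 0 ∨ v p = 1) :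
    ∃ n : ℕ, u ⬝ᵥ C *ᵥ v = n := by
  have h : ∀ p q, ∃ n : ℕ, u p * (C p q * v q) = n := fun p q => by
    rcases hu p with h | h <;> rcases hC p q with h' | h' <;> rcases hv q with h'' | h'' <;>
      first
        | (refine ⟨0, ?_⟩; simp [h, h', h'']; done)
        | exact ⟨1, by simp [h, h', h'']⟩
  choose c hc using h
  exact ⟨∑ p, ∑ q, c p q, by simp [dotProduct, mulVec, Finset.mul_sum, hc]⟩

theorem suppInd_sum {N L : ℕ} {ι : Type*} [Fintype ι] (Z : ι → Matrix (Fin N) (Fin L) ℝ)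
    (hZ : ∀ k k', k ≠ k' → ∀ p : Fin N × Fin L, Z k p.1 p.2 = 0 ∨ Z k' p.1 p.2 = 0) :
    suppInd (∑ k, Z k) = ∑ k, suppInd (Z k) := by
  funext p
  simp only [suppInd, Finset.sum_apply, Matrix.sum_apply]
  by_cases h : ∃ k, Z k p.1 p.2 ≠ 0
  · obtain ⟨k, hk⟩ := h
    have h0 : ∀ k', k' ≠ k → Z k' p.1 p.2 = 0 := fun k' hk' => (hZ k' k hk' p).resolve_right hk
    rw [Finset.sum_eq_single k (fun k' _ h' => h0 k' h') (by simp),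
      Finset.sum_eq_single k (fun k' _ h' => by simp [h0 k' h']) (by simp)]
  · push Not at h
    simp [h]

theorem suppInd_add {N L : ℕ} (A B : Matrix (Fin N) (Fin L) ℝ)
    (h : ∀ p : Fin N × Fin L, A p.1 p.2 = 0 ∨ B p.1 p.2 = 0) :
    suppInd (A + B) = suppInd A + suppInd B := by
  funext p
  rcases h p with h | h <;> simp [suppInd, h]

theorem inStructSet_card {N L : ℕ} {C : Matrix (Fin N × Fin L) (Fin N × Fin L) ℝ} {ι : Type*}
    (T : Finset ι) (Z : ι → Matrix (Fin N) (Fin L) ℝ) (hZ : ∀ i ∈ T, IsElementary C (Z i)) :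
    InStructSet C T.card (∑ i ∈ T, Z i) := by
  refine ⟨fun k => Z (T.equivFin.symm k), ?_, fun k => hZ _ (T.equivFin.symm k).2⟩
  rw [Equiv.sum_comp T.equivFin.symm (fun i : T => Z i), Finset.sum_coe_sort]

/-- Merging two terms of a sum of elementary structures whose sum is elementary. -/
theorem inStructSet_of_add {N L s : ℕ} {C : Matrix (Fin N × Fin L) (Fin N × Fin L) ℝ}
    (Z : Fin s → Matrix (Fin N) (Fin L) ℝ) (hZ : ∀ k, IsElementary C (Z k)) {k k' : Fin s}
    (hk : k ≠ k') (hadd : IsElementary C (Z k + Z k')) :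
    InStructSet C (s - 1) (∑ k, Z k) := by
  have h := inStructSet_card (C := C) (Finset.univ.erase k')
    (Function.update Z k (Z k + Z k')) (fun i _ => by
      by_cases hi : i = k
      · subst hi; simpa using hadd
      · simpa [hi] using hZ i)
  rw [Finset.card_erase_of_mem (Finset.mem_univ _), Finset.card_univ, Fintype.card_fin,
    Finset.sum_update_of_mem (by simp [hk])] at h
  convert h using 1
  rw [← Finset.add_sum_erase _ _ (Finset.mem_univ k'),
    ← Finset.add_sum_erase (Finset.univ.erase k') _ (a := k) (by simp [hk]),
    Finset.sdiff_singleton_eq_erase]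
  abel

theorem normC0_eq_one {N L : ℕ} {C : Matrix (Fin N × Fin L) (Fin N × Fin L) ℝ}
    {Z : Matrix (Fin N) (Fin L) ℝ} (hZ : IsElementary C Z) (h0 : Z ≠ 0) : normC0 C Z = 1 := by
  have h1 : InStructSet C 1 Z := ⟨fun _ => Z, by simp, fun _ => hZ⟩
  refine le_antisymm (Nat.sInf_le h1) (Nat.one_le_iff_ne_zero.2 fun h => h0 ?_)
  have hmem : InStructSet C (normC0 C Z) Z :=
    Nat.sInf_mem (s := {s | InStructSet C s Z}) ⟨1, h1⟩
  rw [h] at hmem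
  obtain ⟨Zs, hZs, -⟩ := hmem
  simpa using hZs

/-- The cross terms between distinct pieces of a minimal disjoint decomposition are at least `1`. -/
theorem one_le_dotProduct_of_minimal {N L s : ℕ}
    {C : Matrix (Fin N × Fin L) (Fin N × Fin L) ℝ} (hsymm : C.IsSymm)
    (hbin : ∀ p q, C p q = 0 ∨ C p q = 1) (Z : Fin s → Matrix (Fin N) (Fin L) ℝ)
    (hs : s = normC0 C (∑ k, Z k)) (hZ : ∀ k, IsElementary C (Z k)) {k k' : Fin s} (hk : k ≠ k')
    (hdisj : ∀ p : Fin N × Fin L, Z k p.1 p.2 = 0 ∨ Z k' p.1 p.2 = 0) :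
    1 ≤ suppInd (Z k) ⬝ᵥ C *ᵥ suppInd (Z k') := by
  obtain ⟨n, hn⟩ := exists_nat_dotProduct_mulVec C hbin (suppInd (Z k)) (suppInd (Z k'))
    (suppInd_eq_zero_or_one _) (suppInd_eq_zero_or_one _)
  rcases Nat.eq_zero_or_pos n with rfl | hpos
  · exfalso
    have hzero : suppInd (Z k) ⬝ᵥ C *ᵥ suppInd (Z k') = 0 := by simpa using hn
    have hzero' : suppInd (Z k') ⬝ᵥ C *ᵥ suppInd (Z k) = 0 := by
      rw [← hzero, dotProduct_mulVec, dotProduct_comm, ← mulVec_transpose, hsymm.eq]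
    have hadd : IsElementary C (Z k + Z k') := by
      have h1 := hZ k
      have h2 := hZ k'
      rw [IsElementary, suppQuad_eq_dotProduct] at h1 h2 ⊢
      simp [suppInd_add _ _ hdisj, mulVec_add, h1, h2, hzero, hzero']
    have hle : normC0 C (∑ k, Z k) ≤ s - 1 := Nat.sInf_le (inStructSet_of_add Z hZ hk hadd)
    have := k.pos
    omega
  · rw [hn]
    exact_mod_cast hpos

theorem sum_suppInd_le {N L : ℕ} (Z : Matrix (Fin N) (Fin L) ℝ) (c : ℕ)
    (h : ∀ l : Fin L, (Finset.univ.filter (fun j : Fin N => Z j l ≠ 0)).card ≤ c) :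
    ∑ p, suppInd Z p ≤ c * L := by
  rw [Fintype.sum_prod_type_right]
  calc ∑ l, ∑ j, suppInd Z (j, l) ≤ ∑ _l : Fin L, (c : ℝ) := by
        refine Finset.sum_le_sum fun l _ => ?_
        simp only [suppInd, Finset.sum_boole]
        exact_mod_cast h l
    _ = c * L := by simp [mul_comm]

/-- The quadratic form counts at most the ordered pairs of distinct support elements. -/
theorem suppQuad_add_sum_le {N L : ℕ} {C : Matrix (Fin N × Fin L) (Fin N × Fin L) ℝ}
    (hbin : ∀ p q, C p q = 0 ∨ C p q = 1) (hdiag : ∀ p, C p p = 0)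
    (X : Matrix (Fin N) (Fin L) ℝ) :
    suppQuad C X + ∑ p, suppInd X p ≤ (∑ p, suppInd X p) ^ 2 := by
  rw [suppQuad, sq, Finset.sum_mul_sum, ← Finset.sum_add_distrib]
  refine Finset.sum_le_sum fun p _ => ?_
  have h : suppInd X p = ∑ q, if p = q then suppInd X p else 0 := by simp
  nth_rewrite 2 [h]
  rw [← Finset.sum_add_distrib]
  refine Finset.sum_le_sum fun q _ => ?_
  split_ifs with hpq
  · subst hpq
    rcases suppInd_eq_zero_or_one X p with h | h <;> simp [h, hdiag]
  · rcases suppInd_eq_zero_or_one X p with h | h <;>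
      rcases suppInd_eq_zero_or_one X q with h' | h' <;>
      rcases hbin p q with h'' | h'' <;> simp [h, h', h'']

theorem one_le_sum_suppInd {N L : ℕ} {X : Matrix (Fin N) (Fin L) ℝ} (hX : X ≠ 0) :
    1 ≤ ∑ p, suppInd X p := by
  obtain ⟨j, l, hjl⟩ : ∃ j l, X j l ≠ 0 := by
    by_contra! h
    exact hX (Matrix.ext h)
  calc (1 : ℝ) = suppInd X (j, l) := by simp [suppInd, hjl]
    _ ≤ ∑ p, suppInd X p := Finset.single_le_sum
        (fun p _ => by rcases suppInd_eq_zero_or_one X p with h | h <;> simp [h])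
        (Finset.mem_univ _)

theorem structural_sparsity_equivalence {N L : ℕ} (hN : 0 < N) (hL : 0 < L)
    (scol : ℕ) (hscol1 : 1 ≤ scol) (hscolN : scol ≤ N)
    (C : Matrix (Fin N × Fin L) (Fin N × Fin L) ℝ)
    (hsymm : C.IsSymm) (hbin : ∀ p q, C p q = 0 ∨ C p q = 1)
    (hdiag : ∀ p, C p p = 0)
    (hcol : ∀ W : Matrix (Fin N) (Fin L) ℝ, normC0 C W = 1 →
      ∀ l : Fin L, (Finset.univ.filter (fun j : Fin N => W j l ≠ 0)).card ≤ scol)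
    (X : Matrix (Fin N) (Fin L) ℝ) (hX : X ≠ 0)
    (s : ℕ) (hs : s = normC0 C X) (hfin : ∃ t : ℕ, InStructSet C t X)
    (hdecomp : ∃ Z : Fin s → Matrix (Fin N) (Fin L) ℝ,
      X = ∑ k, Z k ∧ (∀ k, IsElementary C (Z k)) ∧
      ∀ k k' : Fin s, k ≠ k' →
        ∀ p : Fin N × Fin L, Z k p.1 p.2 = 0 ∨ Z k' p.1 p.2 = 0) :
    (1 / 2 : ℝ) * (s : ℝ) ^ 2 ≤ suppQuad C X + 1 ∧
      suppQuad C X + 1 ≤ (scol : ℝ) ^ 2 * (L : ℝ) ^ 2 * (s : ℝ) ^ 2 := by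
  obtain ⟨Z, rfl, hZ, hdisj⟩ := hdecomp
  have hind := suppInd_sum Z hdisj
  constructor
  · have hq : (s : ℝ) ^ 2 - s ≤ suppQuad C (∑ k, Z k) := by
      rw [suppQuad_eq_dotProduct, hind]
      simp only [mulVec_sum, dotProduct_sum, sum_dotProduct]
      calc (s : ℝ) ^ 2 - s = ∑ k : Fin s, ∑ k' : Fin s, (1 - if k = k' then (1 : ℝ) else 0) := by
            simp [Finset.sum_sub_distrib, sq]
        _ ≤ _ := Finset.sum_le_sum fun k _ => Finset.sum_le_sum fun k' _ => ?_
      split_ifs with hk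
      · subst hk
        have := hZ k
        rw [IsElementary, suppQuad_eq_dotProduct] at this
        simp [this]
      · simpa using one_le_dotProduct_of_minimal hsymm hbin Z hs hZ (Ne.symm hk)
          (hdisj _ _ (Ne.symm hk))
    nlinarith [sq_nonneg ((s : ℝ) - 1)]
  · have hcard : ∑ p, suppInd (∑ k, Z k) p ≤ scol * L * s := by
      simp only [hind, Finset.sum_apply]
      rw [Finset.sum_comm]
      calc ∑ k, ∑ p, suppInd (Z k) p ≤ ∑ _k : Fin s, (scol * L : ℝ) := by
            refine Finset.sum_le_sum fun k _ => sum_suppInd_le _ _ ?_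
            by_cases h0 : Z k = 0
            · simp [h0]
            · exact hcol _ (normC0_eq_one (hZ k) h0)
        _ = scol * L * s := by simp [mul_comm]
    have h1 := one_le_sum_suppInd hX
    have h2 := suppQuad_add_sum_le hbin hdiag (∑ k, Z k)
    have h3 := pow_le_pow_left₀ (zero_le_one.trans h1) hcard 2
    rw [mul_pow, mul_pow] at h3
    linarith
end

section
/- Let C ∈ ℝ^{NL×NL} be symmetric with nonnegative entries, and let X, D ∈ ℝ^{N×L}. Let S = sign(X) (entrywise sign) and let T = {t ∈ ℝ : sign(X + tD) = S entrywise}, i.e., the set of t for which X + tD lies in the orthant ℝ_S^{N×L} of matrices with the same entrywise sign pattern as X. Then the function f : T → ℝ, f(t) = R_C(|X + tD|), agrees on T with a quadratic polynomial in t, and hence is convex or concave on T. Moreover, if sign(D) = S entrywise or sign(D) = −S entrywise (i.e., D ∈ ℝ_S^{N×L} or D ∈ −ℝ_S^{N×L}), then f is convex on T. -/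
open Matrix BigOperators

/-- The regularizer `R_C(Z) = vec(Z)ᵀ C vec(Z)`. -/
noncomputable def regC {N L : ℕ} (C : Matrix (Fin N × Fin L) (Fin N × Fin L) ℝ)
    (Z : Matrix (Fin N) (Fin L) ℝ) : ℝ :=
  ∑ p, ∑ q, Z p.1 p.2 * C p q * Z q.1 q.2

theorem convex_setOf_sign_eq (s : ℝ) : Convex ℝ {y : ℝ | Real.sign y = s} := by
  have hmono : Monotone Real.sign := by
    intro x y hxy
    rcases lt_trichotomy x 0 with hx | rfl | hx
    · rw [Real.sign_of_neg hx]
      rcases Real.sign_apply_eq y with h | h | h <;> rw [h] <;> norm_num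
    · rcases hxy.eq_or_lt with rfl | hy
      · exact le_rfl
      · rw [Real.sign_zero, Real.sign_of_pos hy]
        exact zero_le_one
    · rw [Real.sign_of_pos hx, Real.sign_of_pos (hx.trans_le hxy)]
  exact (Set.ordConnected_singleton.preimage_mono hmono : (Real.sign ⁻¹' {s}).OrdConnected).convex

theorem convex_setOf_sign_add_mul_eq (x d s : ℝ) :
    Convex ℝ {t : ℝ | Real.sign (x + t * d) = s} := by
  intro t ht t' ht' u v hu hv huv
  have h := convex_setOf_sign_eq s ht ht' hu hv huv
  have hcomb : u • (x + t * d) + v • (x + t' * d) = x + (u • t + v • t') * d := by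
    simp only [smul_eq_mul]
    linear_combination x * huv
  rwa [hcomb] at h

theorem convexOn_of_eqOn_quadratic {T : Set ℝ} (hT : Convex ℝ T) {f : ℝ → ℝ} {a b c : ℝ}
    (hf : ∀ t ∈ T, f t = a * t ^ 2 + b * t + c) (ha : 0 ≤ a) : ConvexOn ℝ T f := by
  refine ⟨hT, fun x hx y hy u v hu hv huv => ?_⟩
  rw [hf x hx, hf y hy, hf _ (hT hx hy hu hv huv)]
  obtain rfl : v = 1 - u := by linarith
  simp only [smul_eq_mul]
  have h : 0 ≤ a * (u * (1 - u)) * (x - y) ^ 2 := by positivity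
  linarith

theorem concaveOn_of_eqOn_quadratic {T : Set ℝ} (hT : Convex ℝ T) {f : ℝ → ℝ} {a b c : ℝ}
    (hf : ∀ t ∈ T, f t = a * t ^ 2 + b * t + c) (ha : a ≤ 0) : ConcaveOn ℝ T f := by
  rw [← neg_convexOn_iff]
  refine convexOn_of_eqOn_quadratic (a := -a) (b := -b) (c := -c) hT (fun t ht => ?_)
    (neg_nonneg.2 ha)
  rw [Pi.neg_apply, hf t ht]
  ring

theorem regC_add_smul {N L : ℕ} (C : Matrix (Fin N × Fin L) (Fin N × Fin L) ℝ)
    (Y E : Matrix (Fin N) (Fin L) ℝ) (t : ℝ) :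
    regC C (Y + t • E) = regC C E * t ^ 2 +
      (∑ p, ∑ q, (Y p.1 p.2 * C p q * E q.1 q.2 + E p.1 p.2 * C p q * Y q.1 q.2)) * t +
      regC C Y := by
  simp only [regC, Finset.sum_mul, ← Finset.sum_add_distrib]
  refine Finset.sum_congr rfl fun p _ => Finset.sum_congr rfl fun q _ => ?_
  simp only [Matrix.add_apply, Matrix.smul_apply, smul_eq_mul]
  ring

theorem regC_nonneg {N L : ℕ} {C : Matrix (Fin N × Fin L) (Fin N × Fin L) ℝ}
    (hC : ∀ p q, 0 ≤ C p q) {Z : Matrix (Fin N) (Fin L) ℝ} (hZ : ∀ j l, 0 ≤ Z j l) :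
    0 ≤ regC C Z :=
  Finset.sum_nonneg fun _ _ => Finset.sum_nonneg fun _ _ =>
    mul_nonneg (mul_nonneg (hZ _ _) (hC _ _)) (hZ _ _)

theorem regC_neg {N L : ℕ} (C : Matrix (Fin N × Fin L) (Fin N × Fin L) ℝ)
    (Z : Matrix (Fin N) (Fin L) ℝ) : regC C (-Z) = regC C Z := by
  simp [regC]

theorem sign_mul_self_eq_abs (x : ℝ) : Real.sign x * x = |x| := by
  rcases lt_trichotomy x 0 with hx | rfl | hx
  · rw [Real.sign_of_neg hx, abs_of_neg hx, neg_one_mul]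
  · simp
  · rw [Real.sign_of_pos hx, abs_of_pos hx, one_mul]

theorem convex_concave_geometry {N L : ℕ}
    (C : Matrix (Fin N × Fin L) (Fin N × Fin L) ℝ)
    (hsymm : C.IsSymm) (hnonneg : ∀ p q, 0 ≤ C p q)
    (X D : Matrix (Fin N) (Fin L) ℝ)
    (T : Set ℝ)
    (hT : T = {t : ℝ | ∀ (j : Fin N) (l : Fin L),
      Real.sign (X j l + t * D j l) = Real.sign (X j l)})
    (f : ℝ → ℝ)
    (hf : ∀ t : ℝ, f t = regC C (Matrix.of fun j l => |X j l + t * D j l|)) :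
    (∃ a b c : ℝ, ∀ t ∈ T, f t = a * t ^ 2 + b * t + c) ∧
    (ConvexOn ℝ T f ∨ ConcaveOn ℝ T f) ∧
    (((∀ (j : Fin N) (l : Fin L), Real.sign (D j l) = Real.sign (X j l)) ∨
      (∀ (j : Fin N) (l : Fin L), Real.sign (D j l) = -Real.sign (X j l))) →
      ConvexOn ℝ T f) := by
  set Y : Matrix (Fin N) (Fin L) ℝ := Matrix.of fun j l => Real.sign (X j l) * X j l
  set E : Matrix (Fin N) (Fin L) ℝ := Matrix.of fun j l => Real.sign (X j l) * D j l with hE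
  have hconv : Convex ℝ T := by
    rw [hT]
    simp only [Set.ofPred_forall]
    exact convex_iInter fun j => convex_iInter fun l => convex_setOf_sign_add_mul_eq _ _ _
  have hquad : ∀ t ∈ T, f t = regC C E * t ^ 2 +
      (∑ p, ∑ q, (Y p.1 p.2 * C p q * E q.1 q.2 + E p.1 p.2 * C p q * Y q.1 q.2)) * t +
      regC C Y := by
    intro t ht
    rw [hT] at ht
    rw [hf, ← regC_add_smul]
    congr 1
    ext j l
    simp only [Y, E, Matrix.of_apply, Matrix.add_apply, Matrix.smul_apply, smul_eq_mul]
    rw [← sign_mul_self_eq_abs, ht j l]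
    ring
  refine ⟨⟨_, _, _, hquad⟩, ?_, fun h => convexOn_of_eqOn_quadratic hconv hquad ?_⟩
  · exact (le_total 0 (regC C E)).imp (convexOn_of_eqOn_quadratic hconv hquad)
      (concaveOn_of_eqOn_quadratic hconv hquad)
  · rcases h with h | h
    · refine regC_nonneg hnonneg fun j l => ?_
      rw [hE, Matrix.of_apply, ← h j l, sign_mul_self_eq_abs]
      exact abs_nonneg _
    · rw [← regC_neg]
      refine regC_nonneg hnonneg fun j l => ?_
      rw [hE, Matrix.neg_apply, Matrix.of_apply, ← neg_mul, ← h j l, sign_mul_self_eq_abs]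
      exact abs_nonneg _
end

section
/- Let N ≥ 2 and let x₀ ∈ ℝ^N be a vector with at least two nonzero entries. Then there exist a matrix A ∈ ℝ^{N×N} and a vector y ∈ ℝ^N such that: (i) A x₀ = y and x₀ is a minimum-norm solution of the linear system, i.e., ‖x₀‖₂ ≤ ‖z‖₂ for every z ∈ ℝ^N with Az = y; and (ii) there exists a vector x^sp ∈ ℝ^N with at most 2 nonzero entries such that A x^sp = y and x^sp lies in a different orthant than x₀, i.e., there exists an index i with x^sp_i · (x₀)_i < 0. -/
open Matrix BigOperators

theorem pseudoinverse_counterexample {N : ℕ} (hN : 2 ≤ N)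
    (x0 : Fin N → ℝ)
    (h2sparse : ∃ i j : Fin N, i ≠ j ∧ x0 i ≠ 0 ∧ x0 j ≠ 0) :
    ∃ (A : Matrix (Fin N) (Fin N) ℝ) (y : Fin N → ℝ),
      A.mulVec x0 = y ∧
      (∀ z : Fin N → ℝ, A.mulVec z = y →
        Real.sqrt (∑ i, (x0 i) ^ 2) ≤ Real.sqrt (∑ i, (z i) ^ 2)) ∧
      ∃ xsp : Fin N → ℝ,
        (Finset.univ.filter (fun i : Fin N => xsp i ≠ 0)).card ≤ 2 ∧
        A.mulVec xsp = y ∧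
        ∃ i : Fin N, xsp i * x0 i < 0 := by
  obtain ⟨i, j, hij, hi, hj⟩ := h2sparse
  have hself : ∑ k, x0 k * x0 k = ∑ k, x0 k ^ 2 :=
    Finset.sum_congr rfl fun k _ => (sq (x0 k)).symm
  refine ⟨Matrix.of fun _ k => x0 k, fun _ => ∑ k, x0 k ^ 2, ?_, ?_,
    Pi.single i (-x0 i) + Pi.single j ((∑ k, x0 k ^ 2 + x0 i ^ 2) / x0 j), ?_, ?_, i, ?_⟩
  · funext r
    simpa [Matrix.mulVec, dotProduct] using hself
  · intro z hz
    have hz' : ∑ k, x0 k * z k = ∑ k, x0 k ^ 2 := by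
      simpa [Matrix.mulVec, dotProduct] using congrFun hz i
    have hnonneg : 0 ≤ ∑ k, (z k - x0 k) ^ 2 := Finset.sum_nonneg fun k _ => sq_nonneg _
    have hexpand : ∑ k, (z k - x0 k) ^ 2 =
        ∑ k, z k ^ 2 - 2 * ∑ k, x0 k * z k + ∑ k, x0 k ^ 2 := by
      rw [Finset.mul_sum, ← Finset.sum_sub_distrib, ← Finset.sum_add_distrib]
      exact Finset.sum_congr rfl fun k _ => by ring
    exact Real.sqrt_le_sqrt (by linarith)
  · refine (Finset.card_le_card (t := {i, j}) fun k hk => ?_).trans Finset.card_le_two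
    by_contra hne
    simp only [Finset.mem_insert, Finset.mem_singleton, not_or] at hne
    simp [hne.1, hne.2] at hk
  · funext r
    rw [Matrix.mulVec_add, Pi.add_apply, Matrix.mulVec_single, Matrix.mulVec_single]
    simp
    field_simp
    ring
  · have hpos : 0 < x0 i * x0 i := mul_self_pos.mpr hi
    simpa [hij] using hpos
end

section
/- Fix nonnegative integers a, b and let C ∈ ℝ^{NL×NL} be defined by C_{(j,l),(j',l')} = 0 if |j − j'| ≤ a and |l − l'| ≤ b, and C_{(j,l),(j',l')} = 1 otherwise (indices j,j' ∈ [N], l,l' ∈ [L] treated as integers). Then for every Z ∈ ℝ^{N×L}, vec(Z₀₁)ᵀ C vec(Z₀₁) = 0 if and only if the support of Z is contained in a block of a+1 consecutive row indices and b+1 consecutive column indices, i.e., there exist j₀ ∈ [N] and l₀ ∈ [L] with supp(Z) ⊆ {j₀, j₀+1, …, j₀+a} × {l₀, l₀+1, …, l₀+b}. -/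
open Matrix BigOperators

/-- The quadratic form vanishes exactly when all pairs of support positions are unpenalized. -/
theorem suppQuad_eq_zero_iff {N L : ℕ} {C : Matrix (Fin N × Fin L) (Fin N × Fin L) ℝ}
    (hC : ∀ p q, 0 ≤ C p q) (Z : Matrix (Fin N) (Fin L) ℝ) :
    suppQuad C Z = 0 ↔ ∀ p q : Fin N × Fin L, Z p.1 p.2 ≠ 0 → Z q.1 q.2 ≠ 0 → C p q = 0 := by
  have hind : ∀ p, 0 ≤ suppInd Z p := fun p => by unfold suppInd; split_ifs <;> norm_num
  have hterm : ∀ p q, 0 ≤ suppInd Z p * C p q * suppInd Z q := fun p q =>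
    mul_nonneg (mul_nonneg (hind p) (hC p q)) (hind q)
  unfold suppQuad
  rw [Finset.sum_eq_zero_iff_of_nonneg fun p _ => Finset.sum_nonneg fun q _ => hterm p q]
  refine forall_congr' fun p => ?_
  rw [Finset.sum_eq_zero_iff_of_nonneg fun q _ => hterm p q]
  simp only [Finset.mem_univ, forall_const, suppInd, mul_eq_zero, ite_eq_right_iff, one_ne_zero,
    imp_false, not_not]
  refine forall_congr' fun q => ?_
  tauto

/-- A finite set of integers pairwise within distance `a` lies in the interval of length `a`
starting at its minimum; indexed version on a nonempty set. -/
theorem exists_forall_le_and_le_add {ι : Type*} [Finite ι] {s : Set ι} (hs : s.Nonempty)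
    (f : ι → ℤ) (a : ℕ) (h : ∀ p ∈ s, ∀ q ∈ s, (f p - f q).natAbs ≤ a) :
    ∃ m ∈ s, ∀ p ∈ s, f m ≤ f p ∧ f p ≤ f m + a := by
  obtain ⟨m, hm, hmin⟩ := Set.exists_min_image s f s.toFinite hs
  refine ⟨m, hm, fun p hp => ⟨hmin p hp, ?_⟩⟩
  have := h p hp m hm
  omega

theorem block_sparsity_characterization {N L : ℕ} (hN : 0 < N) (hL : 0 < L)
    (a b : ℕ)
    (C : Matrix (Fin N × Fin L) (Fin N × Fin L) ℝ)
    (hC : ∀ p q : Fin N × Fin L,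
      C p q = if ((p.1 : ℤ) - (q.1 : ℤ)).natAbs ≤ a ∧
                 ((p.2 : ℤ) - (q.2 : ℤ)).natAbs ≤ b then 0 else 1) :
    ∀ Z : Matrix (Fin N) (Fin L) ℝ,
      suppQuad C Z = 0 ↔
        ∃ (j0 : Fin N) (l0 : Fin L), ∀ p : Fin N × Fin L, Z p.1 p.2 ≠ 0 →
          (j0 : ℤ) ≤ (p.1 : ℤ) ∧ (p.1 : ℤ) ≤ (j0 : ℤ) + a ∧
          (l0 : ℤ) ≤ (p.2 : ℤ) ∧ (p.2 : ℤ) ≤ (l0 : ℤ) + b := by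
  intro Z
  rw [suppQuad_eq_zero_iff fun p q => by rw [hC]; split_ifs <;> norm_num]
  simp only [hC, ite_eq_left_iff, one_ne_zero, imp_false, not_not]
  constructor
  · intro h
    rcases Set.eq_empty_or_nonempty {p : Fin N × Fin L | Z p.1 p.2 ≠ 0} with hs | hs
    · exact ⟨⟨0, hN⟩, ⟨0, hL⟩, fun p hp => (Set.eq_empty_iff_forall_notMem.mp hs p hp).elim⟩
    · obtain ⟨m, -, hm⟩ := exists_forall_le_and_le_add hs (fun p => (p.1 : ℤ)) a
        fun p hp q hq => (h p q hp hq).1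
      obtain ⟨n, -, hn⟩ := exists_forall_le_and_le_add hs (fun p => (p.2 : ℤ)) b
        fun p hp q hq => (h p q hp hq).2
      exact ⟨m.1, n.2, fun p hp => ⟨(hm p hp).1, (hm p hp).2, hn p hp⟩⟩
  · rintro ⟨j0, l0, h⟩ p q hp hq
    have h₁ := h p hp
    have h₂ := h q hq
    omega
end

section
/- Let s, m be positive integers, let a_1, …, a_s and a'_1, …, a'_s be unit vectors in ℝ^m, and let ξ, ξ' ∈ ℝ^s. Let α > 0 and ε ≥ 0 and assume: (A) ξ_k ξ'_k ≥ 0 and ⟨a_k, a'_k⟩ ≥ α for all k ∈ [s]; (B) Σ_{k ≠ k'} |ξ_k ξ'_{k'} ⟨a_k, a'_{k'}⟩| ≤ ε, Σ_{k ≠ k'} |ξ_k ξ_{k'} ⟨a_k, a_{k'}⟩| ≤ ε, and Σ_{k ≠ k'} |ξ'_k ξ'_{k'} ⟨a'_k, a'_{k'}⟩| ≤ ε. Set y = Σ_{k=1}^s ξ_k a_k and y' = Σ_{k=1}^s ξ'_k a'_k, and assume y ≠ 0, y' ≠ 0, and α⟨ξ, ξ'⟩ − ε ≥ 0. Then the correlation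 satisfies Corr(y, y') = ⟨y, y'⟩/(‖y‖₂ ‖y'‖₂) ≥ (α⟨ξ, ξ'⟩ − ε) / (√(‖ξ‖₂² + ε) · √(‖ξ'‖₂² + ε)). -/
open BigOperators

/-- The inner product of two linear combinations differs from its diagonal part by at most the
sum of the absolute values of the off-diagonal terms. -/
theorem abs_inner_sum_sub_diag_le {ι κ : Type*} [Fintype ι] [Fintype κ] [DecidableEq κ]
    (b c : κ → ι → ℝ) (x z : κ → ℝ) :
    |∑ i, (∑ k, x k * b k i) * (∑ k, z k * c k i) - ∑ k, x k * z k * ∑ i, b k i * c k i| ≤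
      ∑ k, ∑ k', (if k ≠ k' then |x k * z k' * ∑ i, b k i * c k' i| else 0) := by
  have expand : ∑ i, (∑ k, x k * b k i) * (∑ k, z k * c k i) =
      ∑ k, ∑ k', x k * z k' * ∑ i, b k i * c k' i := by
    simp_rw [Finset.sum_mul_sum, Finset.mul_sum]
    rw [Finset.sum_comm]
    refine Finset.sum_congr rfl fun k _ => ?_
    rw [Finset.sum_comm]
    exact Finset.sum_congr rfl fun k' _ => Finset.sum_congr rfl fun i _ => by ring
  have split : ∑ k, ∑ k', x k * z k' * ∑ i, b k i * c k' i -
      ∑ k, x k * z k * ∑ i, b k i * c k i =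
      ∑ k, ∑ k', (if k ≠ k' then x k * z k' * ∑ i, b k i * c k' i else 0) := by
    rw [← Finset.sum_sub_distrib]
    refine Finset.sum_congr rfl fun k _ => ?_
    rw [sub_eq_iff_eq_add, ← Finset.sum_ite_eq Finset.univ k
      (fun k' => x k * z k' * ∑ i, b k i * c k' i) |>.trans (if_pos (Finset.mem_univ k)),
      ← Finset.sum_add_distrib]
    exact Finset.sum_congr rfl fun k' _ => by by_cases h : k = k' <;> simp [h]
  rw [expand, split]
  refine (Finset.abs_sum_le_sum_abs _ _).trans (Finset.sum_le_sum fun k _ => ?_)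
  refine (Finset.abs_sum_le_sum_abs _ _).trans (Finset.sum_le_sum fun k' _ => ?_)
  split_ifs <;> simp

/-- The squared norm of a linear combination of unit vectors exceeds that of the coefficients by
at most the sum of the absolute values of the off-diagonal terms. -/
theorem sum_sq_linearCombination_le {ι κ : Type*} [Fintype ι] [Fintype κ] [DecidableEq κ]
    (b : κ → ι → ℝ) (hb : ∀ k, Real.sqrt (∑ i, (b k i) ^ 2) = 1) (x : κ → ℝ) {ε : ℝ}
    (hε : ∑ k, ∑ k', (if k ≠ k' then |x k * x k' * ∑ i, b k i * b k' i| else 0) ≤ ε) :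
    ∑ i, (∑ k, x k * b k i) ^ 2 ≤ ∑ k, (x k) ^ 2 + ε := by
  have h := (le_abs_self _).trans ((abs_inner_sum_sub_diag_le b b x x).trans hε)
  have unit : ∀ k, ∑ i, (b k i) ^ 2 = 1 := fun k => Real.sqrt_eq_one.mp (hb k)
  simp only [← sq, unit, mul_one] at h
  linarith

/-- The squared norm of a nonzero real vector is positive. -/
theorem sum_sq_pos_of_ne_zero {ι : Type*} [Fintype ι] {v : ι → ℝ} (hv : v ≠ 0) :
    0 < ∑ i, (v i) ^ 2 := by
  obtain ⟨i, hi⟩ := Function.ne_iff.mp hv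
  exact Finset.sum_pos' (fun j _ => sq_nonneg _) ⟨i, Finset.mem_univ i, sq_pos_of_ne_zero hi⟩

theorem correlation_lower_bound
    {s m : ℕ} (hs : 0 < s) (hm : 0 < m)
    (a a' : Fin s → (Fin m → ℝ))
    (ha : ∀ k, Real.sqrt (∑ i, (a k i) ^ 2) = 1)
    (ha' : ∀ k, Real.sqrt (∑ i, (a' k i) ^ 2) = 1)
    (ξ ξ' : Fin s → ℝ)
    (α : ℝ) (hα : 0 < α) (ε : ℝ) (hε : 0 ≤ ε)
    (hA1 : ∀ k, 0 ≤ ξ k * ξ' k)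
    (hA2 : ∀ k, α ≤ ∑ i, a k i * a' k i)
    (hB1 : ∑ k, ∑ k', (if k ≠ k' then |ξ k * ξ' k' * ∑ i, a k i * a' k' i| else 0) ≤ ε)
    (hB2 : ∑ k, ∑ k', (if k ≠ k' then |ξ k * ξ k' * ∑ i, a k i * a k' i| else 0) ≤ ε)
    (hB3 : ∑ k, ∑ k', (if k ≠ k' then |ξ' k * ξ' k' * ∑ i, a' k i * a' k' i| else 0) ≤ ε)
    (y y' : Fin m → ℝ)
    (hy : ∀ i, y i = ∑ k, ξ k * a k i)
    (hy' : ∀ i, y' i = ∑ k, ξ' k * a' k i)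
    (hy0 : y ≠ 0) (hy'0 : y' ≠ 0)
    (hnum : 0 ≤ α * (∑ k, ξ k * ξ' k) - ε) :
    (α * (∑ k, ξ k * ξ' k) - ε) /
        (Real.sqrt ((∑ k, (ξ k) ^ 2) + ε) * Real.sqrt ((∑ k, (ξ' k) ^ 2) + ε)) ≤
      (∑ i, y i * y' i) /
        (Real.sqrt (∑ i, (y i) ^ 2) * Real.sqrt (∑ i, (y' i) ^ 2)) := by
  have hyy : ∑ i, (y i) ^ 2 ≤ ∑ k, (ξ k) ^ 2 + ε := by
    simpa only [hy] using sum_sq_linearCombination_le a ha ξ hB2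
  have hyy' : ∑ i, (y' i) ^ 2 ≤ ∑ k, (ξ' k) ^ 2 + ε := by
    simpa only [hy'] using sum_sq_linearCombination_le a' ha' ξ' hB3
  have diag : α * ∑ k, ξ k * ξ' k ≤ ∑ k, ξ k * ξ' k * ∑ i, a k i * a' k i := by
    rw [Finset.mul_sum]
    refine Finset.sum_le_sum fun k _ => ?_
    rw [mul_comm α]
    exact mul_le_mul_of_nonneg_left (hA2 k) (hA1 k)
  have num : α * (∑ k, ξ k * ξ' k) - ε ≤ ∑ i, y i * y' i := by
    have h := (neg_le_abs _).trans ((abs_inner_sum_sub_diag_le a a' ξ ξ').trans hB1)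
    simp only [hy, hy']
    linarith
  have pos := Real.sqrt_pos.mpr (sum_sq_pos_of_ne_zero hy0)
  have pos' := Real.sqrt_pos.mpr (sum_sq_pos_of_ne_zero hy'0)
  exact div_le_div₀ (hnum.trans num) num (mul_pos pos pos')
    (mul_le_mul (Real.sqrt_le_sqrt hyy) (Real.sqrt_le_sqrt hyy') pos'.le (Real.sqrt_nonneg _))
end
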